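/- Let u and v be adjacent vertices in a finite tree T, and let T' be obtained by the Kelmans operation from v to u. Then μ(T'; v) ≥ μ(T; v), with equality if and only if v is a leaf of T or T is a path with u as a leaf. -/

import Mathlib

open Finset Polynomial

variable {V : Type*}

/-- The vertex sets of the subtrees of `G` that lie inside the set `S` and contain
the vertex `w` : nonempty connected induced subgraphs. -/
noncomputable def subtreesIn [Fintype V] [DecidableEq V] (G : SimpleGraph V) (S : Set V)
    (w : V) : Finset (Finset V) := by
  classical
  exact Finset.univ.filter fun A => w ∈ A ∧ (A : Set V) ⊆ S ∧ (G.induce (A : Set V)).Connected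

/-- The vertex sets of the subtrees of `G` containing `w`. -/
noncomputable def subtrees [Fintype V] [DecidableEq V] (G : SimpleGraph V) (w : V) :
    Finset (Finset V) := subtreesIn G Set.univ w

/-- The generating polynomial `φ_{T,w}` of subtrees of `G` inside `S` containing `w`,
counted by order. -/
noncomputable def subtreePolyIn [Fintype V] [DecidableEq V] (G : SimpleGraph V) (S : Set V)
    (w : V) : Polynomial ℝ := ∑ A ∈ subtreesIn G S w, X ^ A.card

/-- The generating polynomial `φ_{T,w}` of subtrees of `G` containing `w`. -/
noncomputable def subtreePoly [Fintype V] [DecidableEq V] (G : SimpleGraph V) (w : V) :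
    Polynomial ℝ := subtreePolyIn G Set.univ w

/-- The local mean subtree order `μ(G; w)`: the average order of subtrees of `G`
containing `w`. -/
noncomputable def meanOrder [Fintype V] [DecidableEq V] (G : SimpleGraph V) (w : V) : ℝ :=
  (∑ A ∈ subtrees G w, (A.card : ℝ)) / ((subtrees G w).card : ℝ)

/-- The vertex set of the connected component of `G - D` containing `w`. -/
def compDel (G : SimpleGraph V) (D : Set V) (w : V) : Set V :=
  {x | ∃ p : G.Walk w x, ∀ y ∈ p.support, y ∉ D}

/-- The neighbours of `u` as a `Finset`. -/
noncomputable def nbrFinset [Fintype V] (G : SimpleGraph V) (u : V) : Finset V := by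
  classical
  exact Finset.univ.filter fun w => G.Adj u w

/-- `G` is a path: a tree all of whose vertices have degree at most `2`. -/
def IsPathGraph [Fintype V] (G : SimpleGraph V) : Prop :=
  G.IsTree ∧ ∀ v : V, (G.neighborSet v).ncard ≤ 2

/-- The induced subgraph of `G` on `S` is a path (as a subgraph of a tree:
connected with all degrees within `S` at most `2`). -/
def IsPathOn (G : SimpleGraph V) (S : Set V) : Prop :=
  (G.induce S).Connected ∧ ∀ x ∈ S, (G.neighborSet x ∩ S).ncard ≤ 2

/-- The partial Kelmans operation on `G` from `v` to `u`, moving the edges between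
`v` and the set `W`: each edge `v w`, `w ∈ W`, is replaced by the edge `u w`. -/
def pkelmans (G : SimpleGraph V) (v u : V) (W : Set V) : SimpleGraph V :=
  SimpleGraph.fromRel fun a b =>
    (G.Adj a b ∧ ¬(a = v ∧ b ∈ W) ∧ ¬(b = v ∧ a ∈ W)) ∨
    (a = u ∧ b ∈ W ∧ G.Adj v b)

/-- The Kelmans operation on `G` from `v` to `u`: every edge `v w` with
`w ∈ N(v) \ {u}` is replaced by the edge `u w`. -/
def kelmans (G : SimpleGraph V) (v u : V) : SimpleGraph V :=
  pkelmans G v u (G.neighborSet v \ {u})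

/-- Connectedness of the vertex set `C` from its element `v`, as an induction principle. -/
def RootConn {V : Type*} (G : SimpleGraph V) (v : V) (C : Finset V) : Prop :=
  v ∈ C ∧ ∀ P : V → Prop, P v → (∀ x ∈ C, ∀ y ∈ C, P x → G.Adj x y → P y) → ∀ x ∈ C, P x

theorem rootConn_iff {V : Type*} (G : SimpleGraph V) (v : V) (C : Finset V) :
    RootConn G v C ↔ v ∈ C ∧ (G.induce (C : Set V)).Connected := by
  constructor
  · rintro ⟨hv, h⟩
    refine ⟨hv, ?_⟩
    have key := h (fun x => ∀ hx : x ∈ (C : Set V),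
      (G.induce (C : Set V)).Reachable ⟨v, hv⟩ ⟨x, hx⟩) (fun _ => SimpleGraph.Reachable.refl _) (by
        intro x hx y hy hP hxy hy'
        refine (hP hx).trans (SimpleGraph.Adj.reachable ?_)
        simpa using hxy)
    have : Nonempty (C : Set V) := ⟨⟨v, hv⟩⟩
    refine SimpleGraph.Connected.mk fun x y => ?_
    exact (key x.1 x.2 x.2).symm.trans (key y.1 y.2 y.2)
  · rintro ⟨hv, h⟩
    refine ⟨hv, fun P hP hstep x hx => ?_⟩
    obtain ⟨p⟩ := h.preconnected ⟨v, hv⟩ ⟨x, hx⟩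
    have walk : ∀ {a b : (C : Set V)}, (G.induce (C : Set V)).Walk a b → P a.1 → P b.1 := by
      intro a b p
      induction p with
      | nil => exact id
      | cons hadj _ ih =>
        intro ha
        exact ih (hstep _ (Subtype.coe_prop _) _ (Subtype.coe_prop _) ha (by simpa using hadj))
    exact walk p hP

theorem RootConn.singleton {V : Type*} (G : SimpleGraph V) (v : V) : RootConn G v {v} := by
  refine ⟨by simp, fun P hP _ x hx => ?_⟩
  rw [Finset.mem_singleton] at hx
  exact hx ▸ hP

theorem RootConn.insert {V : Type*} [DecidableEq V] {G : SimpleGraph V} {v x y : V}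
    {C : Finset V} (h : RootConn G v C) (hx : x ∈ C) (hxy : G.Adj x y) :
    RootConn G v (insert y C) := by
  refine ⟨Finset.mem_insert_of_mem h.1, fun P hP hstep => ?_⟩
  have hC : ∀ z ∈ C, P z := h.2 P hP fun a ha b hb =>
    hstep a (Finset.mem_insert_of_mem ha) b (Finset.mem_insert_of_mem hb)
  intro z hz
  rcases Finset.mem_insert.1 hz with rfl | hz
  · exact hstep x (Finset.mem_insert_of_mem hx) z (Finset.mem_insert_self _ _) (hC x hx) hxy
  · exact hC z hz

theorem RootConn.exists_adj {V : Type*} {G : SimpleGraph V} {v : V} {C D : Finset V}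
    (h : RootConn G v C) (hv : v ∈ D) (hCD : ¬ C ⊆ D) :
    ∃ x ∈ C, x ∈ D ∧ ∃ y ∈ C, y ∉ D ∧ G.Adj x y := by
  by_contra! hcon
  exact hCD fun z hz => h.2 (fun z => z ∈ D) hv
    (fun x hx y hy hxD hxy => by_contra fun hyD => hcon x hx hxD y hy hyD hxy) z hz

theorem RootConn.exists_subset_card_eq {V : Type*} [DecidableEq V] {G : SimpleGraph V} {v : V}
    {C : Finset V} (h : RootConn G v C) (k : ℕ) (hk : k + 1 ≤ C.card) :
    ∃ D ⊆ C, RootConn G v D ∧ D.card = k + 1 := by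
  induction k with
  | zero => exact ⟨{v}, by simpa using h.1, RootConn.singleton G v, by simp⟩
  | succ k ih =>
    obtain ⟨D, hDC, hD, hcard⟩ := ih (by omega)
    obtain ⟨x, -, hxD, y, hyC, hyD, hxy⟩ := h.exists_adj hD.1 (fun hCD => by
      have := Finset.card_le_card hCD
      omega)
    refine ⟨Insert.insert y D, Finset.insert_subset hyC hDC, hD.insert hxD hxy, ?_⟩
    rw [Finset.card_insert_of_notMem hyD, hcard]

/-- A rooted connected set with at least two vertices arises by attaching one vertex to a
smaller rooted connected set. -/
theorem RootConn.exists_eq_insert {V : Type*} [DecidableEq V] {G : SimpleGraph V} {v : V}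
    {C : Finset V} (h : RootConn G v C) {k : ℕ} (hk : C.card = k + 2) :
    ∃ D x y, RootConn G v D ∧ D.card = k + 1 ∧ x ∈ D ∧ y ∉ D ∧ G.Adj x y ∧
      C = Insert.insert y D := by
  obtain ⟨D, hDC, hD, hcard⟩ := h.exists_subset_card_eq k (by omega)
  obtain ⟨x, -, hxD, y, hyC, hyD, hxy⟩ := h.exists_adj hD.1 (fun hCD => by
    have := Finset.card_le_card hCD
    omega)
  refine ⟨D, x, y, hD, hcard, hxD, hyD, hxy, ?_⟩
  refine (Finset.eq_of_subset_of_card_le (Finset.insert_subset hyC hDC) ?_).symm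
  rw [Finset.card_insert_of_notMem hyD]
  omega

/-- The vertex sets of the subtrees containing `v` but not `u`. -/
noncomputable def subtreesAvoiding {V : Type*} [Fintype V] (G : SimpleGraph V) (v u : V) :
    Finset (Finset V) := by
  classical
  exact Finset.univ.filter fun C => RootConn G v C ∧ u ∉ C

/-- The vertex sets of the subtrees containing both `v` and `u`. -/
noncomputable def subtreesBoth {V : Type*} [Fintype V] (G : SimpleGraph V) (v u : V) :
    Finset (Finset V) := by
  classical
  exact Finset.univ.filter fun C => RootConn G v C ∧ u ∈ C

theorem mem_subtreesAvoiding {V : Type*} [Fintype V] {G : SimpleGraph V} {v u : V}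
    {C : Finset V} : C ∈ subtreesAvoiding G v u ↔ RootConn G v C ∧ u ∉ C := by
  simp [subtreesAvoiding]

theorem mem_subtreesBoth {V : Type*} [Fintype V] {G : SimpleGraph V} {v u : V}
    {C : Finset V} : C ∈ subtreesBoth G v u ↔ RootConn G v C ∧ u ∈ C := by
  simp [subtreesBoth]

theorem singleton_mem_subtreesAvoiding {V : Type*} [Fintype V] (G : SimpleGraph V) {v u : V}
    (h : u ≠ v) : {v} ∈ subtreesAvoiding G v u :=
  mem_subtreesAvoiding.2 ⟨RootConn.singleton G v, by simpa using h⟩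

theorem subtrees_eq_union {V : Type*} [Fintype V] [DecidableEq V] (G : SimpleGraph V) (v u : V) :
    subtrees G v = subtreesAvoiding G v u ∪ subtreesBoth G v u := by
  ext C
  simp only [subtrees, subtreesIn, Finset.mem_filter, Finset.mem_univ, true_and,
    Set.subset_univ, Finset.mem_union, mem_subtreesAvoiding, mem_subtreesBoth, rootConn_iff]
  tauto

theorem meanOrder_eq {V : Type*} [Fintype V] [DecidableEq V] (G : SimpleGraph V) (v u : V) :
    meanOrder G v =
      (∑ C ∈ subtreesAvoiding G v u, (C.card : ℝ) + ∑ C ∈ subtreesBoth G v u, (C.card : ℝ)) /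
        ((subtreesAvoiding G v u).card + (subtreesBoth G v u).card) := by
  have hd : Disjoint (subtreesAvoiding G v u) (subtreesBoth G v u) :=
    Finset.disjoint_left.2 fun C h h' =>
      (mem_subtreesAvoiding.1 h).2 (mem_subtreesBoth.1 h').2
  rw [meanOrder, subtrees_eq_union G v u, Finset.sum_union hd, Finset.card_union_of_disjoint hd]
  push_cast
  rfl

/-- The subtrees avoiding the neighbour `u` of `v` reduce to `{v}` exactly when `v` is a leaf. -/
theorem subtreesAvoiding_eq_singleton_iff {V : Type*} [Fintype V] [DecidableEq V]
    {G : SimpleGraph V} {v u : V} (h : G.Adj v u) :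
    subtreesAvoiding G v u = {{v}} ↔ ∀ w, G.Adj v w → w = u := by
  constructor
  · intro hF w hw
    by_contra hne
    have hmem : insert w {v} ∈ subtreesAvoiding G v u := by
      refine mem_subtreesAvoiding.2 ⟨(RootConn.singleton G v).insert (by simp) hw, ?_⟩
      simp [Ne.symm hne, h.ne']
    rw [hF, Finset.mem_singleton] at hmem
    have hwv : w ∈ ({v} : Finset V) := hmem ▸ Finset.mem_insert_self _ _
    exact hw.ne' (by simpa using hwv)
  · intro hN
    refine Finset.eq_singleton_iff_unique_mem.2
      ⟨singleton_mem_subtreesAvoiding G h.ne', fun C hC => ?_⟩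
    obtain ⟨hC, huC⟩ := mem_subtreesAvoiding.1 hC
    refine Finset.Subset.antisymm ?_ (by simpa using hC.1)
    by_contra hsub
    obtain ⟨x, -, hx, y, hyC, -, hxy⟩ := hC.exists_adj (Finset.mem_singleton_self v) hsub
    rw [Finset.mem_singleton] at hx
    subst hx
    exact huC (hN y hxy ▸ hyC)

theorem ncard_neighborSet_eq_one_iff {V : Type*} {G : SimpleGraph V} {v u : V}
    (h : G.Adj v u) : (G.neighborSet v).ncard = 1 ↔ ∀ w, G.Adj v w → w = u := by
  rw [Set.ncard_eq_one]
  constructor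
  · rintro ⟨z, hz⟩ w hw
    have hu : u ∈ G.neighborSet v := h
    have hw : w ∈ G.neighborSet v := hw
    rw [hz] at hu hw
    exact hw.trans hu.symm
  · intro hN
    exact ⟨u, Set.eq_singleton_iff_unique_mem.2 ⟨h, hN⟩⟩

theorem card_subtreesAvoiding_eq_one_iff {V : Type*} [Fintype V] [DecidableEq V]
    {G : SimpleGraph V} {v u : V} (h : G.Adj v u) :
    (subtreesAvoiding G v u).card = 1 ↔ subtreesAvoiding G v u = {{v}} := by
  constructor
  · intro h1
    obtain ⟨C, hC⟩ := Finset.card_eq_one.1 h1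
    have := singleton_mem_subtreesAvoiding G h.ne'
    rw [hC, Finset.mem_singleton] at this
    rw [hC, this]
  · intro h1
    rw [h1, Finset.card_singleton]

/-- Deleting the edge `uv` of a tree leaves a side of `v` that only this edge leaves. -/
theorem exists_side {V : Type*} {G : SimpleGraph V} (hG : G.IsAcyclic) {u v : V}
    (huv : G.Adj u v) :
    ∃ S : Set V, v ∈ S ∧ u ∉ S ∧ ∀ x y, G.Adj x y → x ∈ S → y ∉ S → x = v ∧ y = u := by
  have hb := SimpleGraph.isAcyclic_iff_forall_adj_isBridge.1 hG huv
  rw [SimpleGraph.isBridge_iff] at hb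
  refine ⟨{x | (G \ SimpleGraph.fromEdgeSet {s(u, v)}).Reachable v x},
    SimpleGraph.Reachable.refl _, fun h => hb h.symm, ?_⟩
  intro x y hxy hx hy
  by_cases hs : s(x, y) = s(u, v)
  · rcases Sym2.eq_iff.1 hs with ⟨rfl, rfl⟩ | ⟨rfl, rfl⟩
    · exact absurd hx (fun h => hb h.symm)
    · exact ⟨rfl, rfl⟩
  · refine absurd (SimpleGraph.Reachable.trans hx (SimpleGraph.Adj.reachable ?_)) hy
    simp [hxy, hs]

/-- Subtrees containing both ends of an edge split into a subtree on each side. -/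
theorem sum_subtreesBoth {V : Type*} [Fintype V] [DecidableEq V] {G : SimpleGraph V}
    (hG : G.IsAcyclic) {u v : V} (huv : G.Adj u v) (f : ℕ → ℝ) :
    ∑ C ∈ subtreesBoth G v u, f C.card =
      ∑ p ∈ subtreesAvoiding G u v ×ˢ subtreesAvoiding G v u, f (p.1.card + p.2.card) := by
  classical
  obtain ⟨S, hvS, huS, hS⟩ := exists_side hG huv
  have sideA : ∀ A ∈ subtreesAvoiding G u v, ∀ x ∈ A, x ∉ S := by
    intro A hA
    obtain ⟨hA, hvA⟩ := mem_subtreesAvoiding.1 hA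
    refine hA.2 (fun x => x ∉ S) huS fun x hx y hy hxS hxy hyS => ?_
    exact hvA ((hS y x hxy.symm hyS hxS).1 ▸ hy)
  have sideB : ∀ B ∈ subtreesAvoiding G v u, ∀ x ∈ B, x ∈ S := by
    intro B hB
    obtain ⟨hB, huB⟩ := mem_subtreesAvoiding.1 hB
    refine hB.2 (fun x => x ∈ S) hvS fun x hx y hy hxS hxy => ?_
    by_contra hyS
    exact huB ((hS x y hxy hxS hyS).2 ▸ hy)
  refine Finset.sum_bij' (fun C _ => (C.filter (· ∉ S), C.filter (· ∈ S)))
    (fun p _ => p.1 ∪ p.2) ?_ ?_ ?_ ?_ ?_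
  · intro C hC
    obtain ⟨hC, huC⟩ := mem_subtreesBoth.1 hC
    simp only [Finset.mem_product, mem_subtreesAvoiding]
    refine ⟨⟨⟨by simp [huC, huS], fun P hP hstep => ?_⟩, by simp [hvS]⟩,
      ⟨⟨by simp [hC.1, hvS], fun P hP hstep => ?_⟩, by simp [huS]⟩⟩
    · have := hC.2 (fun x => x ∉ S → P x) (fun h => absurd hvS h) (by
        intro x hx y hy hPx hxy hyS
        by_cases hxS : x ∈ S
        · exact (hS x y hxy hxS hyS).2 ▸ hP
        · exact hstep x (by simp [hx, hxS]) y (by simp [hy, hyS]) (hPx hxS) hxy)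
      intro x hx
      rw [Finset.mem_filter] at hx
      exact this x hx.1 hx.2
    · have := hC.2 (fun x => x ∈ S → P x) (fun _ => hP) (by
        intro x hx y hy hPx hxy hyS
        by_cases hxS : x ∈ S
        · exact hstep x (by simp [hx, hxS]) y (by simp [hy, hyS]) (hPx hxS) hxy
        · exact (hS y x hxy.symm hyS hxS).1 ▸ hP)
      intro x hx
      rw [Finset.mem_filter] at hx
      exact this x hx.1 hx.2
  · rintro ⟨A, B⟩ hp
    obtain ⟨hA, hB⟩ := Finset.mem_product.1 hp
    have hA := (mem_subtreesAvoiding.1 hA).1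
    have hB := (mem_subtreesAvoiding.1 hB).1
    refine mem_subtreesBoth.2 ⟨⟨Finset.mem_union_right _ hB.1, fun P hP hstep => ?_⟩,
      Finset.mem_union_left _ hA.1⟩
    have hPu : P u := hstep v (Finset.mem_union_right _ hB.1) u (Finset.mem_union_left _ hA.1)
      hP huv.symm
    intro x hx
    rcases Finset.mem_union.1 hx with hx | hx
    · exact hA.2 P hPu (fun x hx y hy => hstep x (Finset.mem_union_left _ hx) y
        (Finset.mem_union_left _ hy)) x hx
    · exact hB.2 P hP (fun x hx y hy => hstep x (Finset.mem_union_right _ hx) y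
        (Finset.mem_union_right _ hy)) x hx
  · intro C _
    ext x
    simp only [Finset.mem_union, Finset.mem_filter]
    tauto
  · rintro ⟨A, B⟩ hp
    obtain ⟨hA, hB⟩ := Finset.mem_product.1 hp
    have hA := sideA A hA
    have hB := sideB B hB
    ext x
    · simp only [Finset.mem_union, Finset.mem_filter]
      grind
    · simp only [Finset.mem_union, Finset.mem_filter]
      grind
  · intro C _
    congr 1
    rw [add_comm]
    exact (Finset.card_filter_add_card_filter_not (s := C) (· ∈ S)).symm

theorem card_subtreesBoth {V : Type*} [Fintype V] [DecidableEq V] {G : SimpleGraph V}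
    (hG : G.IsAcyclic) {u v : V} (huv : G.Adj u v) :
    ((subtreesBoth G v u).card : ℝ) =
      (subtreesAvoiding G u v).card * (subtreesAvoiding G v u).card := by
  simpa using sum_subtreesBoth hG huv (fun _ => 1)

theorem sum_card_subtreesBoth {V : Type*} [Fintype V] [DecidableEq V] {G : SimpleGraph V}
    (hG : G.IsAcyclic) {u v : V} (huv : G.Adj u v) :
    ∑ C ∈ subtreesBoth G v u, (C.card : ℝ) =
      (∑ C ∈ subtreesAvoiding G u v, (C.card : ℝ)) * (subtreesAvoiding G v u).card +
        (subtreesAvoiding G u v).card * ∑ C ∈ subtreesAvoiding G v u, (C.card : ℝ) := by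
  rw [sum_subtreesBoth hG huv (fun n => (n : ℝ)), Finset.sum_product]
  simp only [Nat.cast_add, Finset.sum_add_distrib, Finset.sum_const, nsmul_eq_mul,
    Finset.mul_sum, mul_comm]

theorem kelmans_adj {V : Type*} {G : SimpleGraph V} {u v : V} {x y : V} :
    (kelmans G v u).Adj x y ↔ x ≠ y ∧
      ((G.Adj x y ∧ (x = v → y = u) ∧ (y = v → x = u)) ∨
        (x = u ∧ y ≠ u ∧ G.Adj v y) ∨ (y = u ∧ x ≠ u ∧ G.Adj v x)) := by
  simp only [kelmans, pkelmans, SimpleGraph.fromRel_adj, Set.mem_sdiff, Set.mem_singleton_iff,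
    SimpleGraph.mem_neighborSet]
  have := G.adj_comm x y
  have hx := G.adj_comm x v
  have hy := G.adj_comm y v
  grind

theorem kelmans_adj_self {V : Type*} {G : SimpleGraph V} {u v : V} (huv : G.Adj u v) {w : V} :
    (kelmans G v u).Adj v w ↔ w = u := by
  have h1 := huv.ne
  have h2 := huv.symm
  rw [kelmans_adj]
  have := G.irrefl (v := v)
  grind

/-- The Kelmans operation does not change the subtrees containing both `u` and `v`. -/
theorem subtreesBoth_kelmans {V : Type*} [Fintype V] {G : SimpleGraph V} {u v : V}
    (huv : G.Adj u v) : subtreesBoth (kelmans G v u) v u = subtreesBoth G v u := by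
  ext C
  simp only [mem_subtreesBoth]
  refine and_congr_left fun huC => and_congr_right fun hvC => forall_congr' fun P =>
    forall_congr' fun hP => imp_congr_left ⟨fun h => ?_, fun h => ?_⟩
  · have hPu : P u := h v hvC u huC hP ((kelmans_adj_self huv).2 rfl)
    intro x hx y hy hPx hxy
    by_cases hyv : y = v
    · exact hyv ▸ hP
    by_cases hyu : y = u
    · exact hyu ▸ hPu
    by_cases hxv : x = v
    · subst hxv
      exact h u huC y hy hPu (kelmans_adj.2 ⟨Ne.symm hyu, Or.inr (Or.inl ⟨rfl, hyu, hxy⟩)⟩)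
    · exact h x hx y hy hPx (kelmans_adj.2 ⟨hxy.ne, Or.inl ⟨hxy, fun h => absurd h hxv,
        fun h => absurd h hyv⟩⟩)
  · have hPu : P u := h v hvC u huC hP huv.symm
    intro x hx y hy hPx hxy
    obtain ⟨-, ⟨hxy, -⟩ | ⟨-, -, hxy⟩ | ⟨rfl, -⟩⟩ := kelmans_adj.1 hxy
    · exact h x hx y hy hPx hxy
    · exact h v hvC y hy hP hxy
    · exact hPu

theorem subtreesAvoiding_kelmans {V : Type*} [Fintype V] [DecidableEq V] {G : SimpleGraph V}
    {u v : V} (huv : G.Adj u v) : subtreesAvoiding (kelmans G v u) v u = {{v}} :=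
  (subtreesAvoiding_eq_singleton_iff ((kelmans_adj_self huv).2 rfl)).2
    fun _ => (kelmans_adj_self huv).1

/-- If a family of finite sets of sizes at least one realises every smaller positive size, its
total size is at most that of sizes `1, …, n`, with equality when the sizes are distinct. -/
theorem two_mul_sum_card_le {V : Type*} [DecidableEq V] (F : Finset (Finset V))
    (hF : ∀ A ∈ F, 1 ≤ A.card)
    (hF' : ∀ A ∈ F, ∀ k, 1 ≤ k → k ≤ A.card → ∃ D ∈ F, D.card = k) :
    2 * ∑ A ∈ F, A.card ≤ F.card * F.card + F.card ∧
      (2 * ∑ A ∈ F, A.card = F.card * F.card + F.card ↔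
        Set.InjOn Finset.card (F : Set (Finset V))) := by
  set L : Finset V → ℕ := fun A => (F.filter fun D => D.card < A.card).card with hL
  set R : Finset V → ℕ := fun A => (F.filter fun D => A.card < D.card).card with hR
  set E : Finset V → ℕ := fun A => (F.filter fun D => D.card = A.card).card with hE
  have hLR : ∑ A ∈ F, L A = ∑ A ∈ F, R A := by
    simp only [hL, hR, Finset.card_filter]
    exact Finset.sum_comm
  have hsplit : ∀ A, L A + E A + R A = F.card := by
    intro A
    simp only [hL, hR, hE, Finset.card_filter, ← Finset.sum_add_distrib]
    rw [Finset.card_eq_sum_ones F]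
    refine Finset.sum_congr rfl fun D _ => ?_
    rcases lt_trichotomy D.card A.card with h | h | h
    · simp [h, h.ne, h.le]
    · simp [h]
    · simp [h, h.ne', h.le]
  have htotal : ∑ A ∈ F, L A + ∑ A ∈ F, E A + ∑ A ∈ F, R A = F.card * F.card := by
    simp only [← Finset.sum_add_distrib, hsplit, Finset.sum_const, smul_eq_mul]
  have hEpos : ∀ A ∈ F, 1 ≤ E A := fun A hA =>
    Finset.card_pos.2 ⟨A, Finset.mem_filter.2 ⟨hA, rfl⟩⟩
  have hLimage : ∀ A ∈ F, Finset.Ico 1 A.card =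
      (F.filter fun D => D.card < A.card).image Finset.card := by
    intro A hA
    ext k
    simp only [Finset.mem_Ico, Finset.mem_image, Finset.mem_filter]
    constructor
    · rintro ⟨h1, h2⟩
      obtain ⟨D, hD, rfl⟩ := hF' A hA k h1 h2.le
      exact ⟨D, ⟨hD, h2⟩, rfl⟩
    · rintro ⟨D, ⟨hD, hDA⟩, rfl⟩
      exact ⟨hF D hD, hDA⟩
  have hLge : ∀ A ∈ F, A.card ≤ L A + 1 := by
    intro A hA
    have h1 := congrArg Finset.card (hLimage A hA)
    rw [Nat.card_Ico] at h1
    have h2 : _ ≤ L A := Finset.card_image_le (s := F.filter fun D => D.card < A.card)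
      (f := Finset.card)
    omega
  have hsum1 : ∑ A ∈ F, A.card ≤ ∑ A ∈ F, L A + F.card := by
    have := Finset.sum_le_sum hLge
    simpa [Finset.sum_add_distrib] using this
  have hsum2 : F.card ≤ ∑ A ∈ F, E A := by
    have := Finset.sum_le_sum hEpos
    simpa using this
  refine ⟨by omega, fun heq => ?_, fun hinj => ?_⟩
  · have hEsum : ∑ A ∈ F, 1 = ∑ A ∈ F, E A := by
      rw [← Finset.card_eq_sum_ones]
      omega
    have hE1 := (Finset.sum_eq_sum_iff_of_le hEpos).1 hEsum
    intro A hA D hD hAD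
    exact Finset.card_le_one.1 (hE1 A hA).symm.le A (Finset.mem_filter.2 ⟨hA, rfl⟩) D
      (Finset.mem_filter.2 ⟨hD, hAD.symm⟩)
  · have hE1 : ∑ A ∈ F, E A = F.card := by
      rw [Finset.card_eq_sum_ones]
      refine Finset.sum_congr rfl fun A hA => le_antisymm ?_ (hEpos A hA)
      refine Finset.card_le_one.2 fun B hB D hD => ?_
      rw [Finset.mem_filter] at hB hD
      exact hinj hB.1 hD.1 (hB.2.trans hD.2.symm)
    have hL1 : ∑ A ∈ F, A.card = ∑ A ∈ F, (L A + 1) := by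
      refine Finset.sum_congr rfl fun A hA => ?_
      have h1 := congrArg Finset.card (hLimage A hA)
      rw [Nat.card_Ico, Finset.card_image_of_injOn (hinj.mono (by
        intro D hD
        exact (Finset.mem_filter.1 hD).1))] at h1
      have := hF A hA
      simp only [hL]
      omega
    simp only [Finset.sum_add_distrib, Finset.sum_const, smul_eq_mul, mul_one] at hL1
    omega

theorem two_mul_sum_card_subtreesAvoiding_le {V : Type*} [Fintype V] [DecidableEq V]
    (G : SimpleGraph V) (v u : V) :
    2 * ∑ A ∈ subtreesAvoiding G v u, A.card ≤
        (subtreesAvoiding G v u).card * (subtreesAvoiding G v u).card +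
          (subtreesAvoiding G v u).card ∧
      (2 * ∑ A ∈ subtreesAvoiding G v u, A.card =
        (subtreesAvoiding G v u).card * (subtreesAvoiding G v u).card +
          (subtreesAvoiding G v u).card ↔
        Set.InjOn Finset.card (subtreesAvoiding G v u : Set (Finset V))) := by
  refine two_mul_sum_card_le _ (fun A hA => ?_) (fun A hA k hk hkA => ?_)
  · exact Finset.card_pos.2 ⟨v, (mem_subtreesAvoiding.1 hA).1.1⟩
  · obtain ⟨hA, huA⟩ := mem_subtreesAvoiding.1 hA
    obtain ⟨D, hDA, hD, hcard⟩ := hA.exists_subset_card_eq (k - 1) (by omega)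
    exact ⟨D, mem_subtreesAvoiding.2 ⟨hD, fun h => huA (hDA h)⟩, by omega⟩

/-- In a graph of maximum degree two, the subtrees containing `v` and avoiding its neighbour `u`
are determined by their order. -/
theorem injOn_card_of_degree_le_two {V : Type*} [Fintype V] [DecidableEq V]
    {G : SimpleGraph V} {u v : V} (huv : G.Adj u v)
    (hdeg : ∀ x, (G.neighborSet x).ncard ≤ 2) :
    Set.InjOn Finset.card (subtreesAvoiding G v u : Set (Finset V)) := by
  have hdeg' : ∀ x a b c, G.Adj x a → G.Adj x b → G.Adj x c → a ≠ b → a ≠ c → b = c := by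
    intro x a b c ha hb hc hab hac
    by_contra hbc
    have := (Set.two_lt_ncard_iff (Set.toFinite (G.neighborSet x))).2
      ⟨a, b, c, ha, hb, hc, hab, hac, hbc⟩
    exact absurd (hdeg x) (by omega)
  have key : ∀ k, ∀ C ∈ subtreesAvoiding G v u, C.card = k + 1 →
      (∀ C' ∈ subtreesAvoiding G v u, C'.card = k + 1 → C' = C) ∧
      ∀ x ∈ C, ∀ y, y ∉ C → y ≠ u → G.Adj x y → ∀ x' ∈ C, ∀ y', y' ∉ C → y' ≠ u →
        G.Adj x' y' → y = y' := by
    intro k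
    induction k with
    | zero =>
      have hsing : ∀ C ∈ subtreesAvoiding G v u, C.card = 0 + 1 → C = {v} := by
        intro C hC hk
        exact (Finset.eq_of_subset_of_card_le
          (Finset.singleton_subset_iff.2 (mem_subtreesAvoiding.1 hC).1.1) (by simp [hk])).symm
      intro C hC hk
      rw [hsing C hC hk]
      refine ⟨hsing, fun x hx y _ hyu hxy x' hx' y' _ hyu' hxy' => ?_⟩
      rw [Finset.mem_singleton] at hx hx'
      exact hdeg' v u y y' huv.symm (hx ▸ hxy) (hx' ▸ hxy') hyu.symm hyu'.symm
    | succ k ih =>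
      have hdecomp : ∀ C ∈ subtreesAvoiding G v u, C.card = k + 1 + 1 →
          ∃ D x y, D ∈ subtreesAvoiding G v u ∧ D.card = k + 1 ∧ x ∈ D ∧ y ∉ D ∧ y ≠ u ∧
            G.Adj x y ∧ C = insert y D := by
        intro C hC hk
        obtain ⟨hC, huC⟩ := mem_subtreesAvoiding.1 hC
        obtain ⟨D, x, y, hD, hDk, hx, hy, hxy, rfl⟩ := hC.exists_eq_insert hk
        simp only [Finset.mem_insert, not_or] at huC
        exact ⟨D, x, y, mem_subtreesAvoiding.2 ⟨hD, huC.2⟩, hDk, hx, hy, Ne.symm huC.1, hxy, rfl⟩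
      intro C hC hk
      obtain ⟨D, x, y, hD, hDk, hx, hy, hyu, hxy, rfl⟩ := hdecomp C hC hk
      obtain ⟨huniq, hbd⟩ := ih D hD hDk
      refine ⟨fun C' hC' hk' => ?_, ?_⟩
      · obtain ⟨D', x', y', hD', hDk', hx', hy', hyu', hxy', rfl⟩ := hdecomp C' hC' hk'
        obtain rfl := huniq D' hD' hDk'
        rw [hbd x hx y hy hyu hxy x' hx' y' hy' hyu' hxy']
      · have hnew : ∀ p ∈ insert y D, ∀ q, q ∉ insert y D → q ≠ u → G.Adj p q → p = y := by
          intro p hp q hq hqu hpq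
          simp only [Finset.mem_insert, not_or] at hp hq
          rcases hp with hp | hp
          · exact hp
          · exact absurd (hbd p hp q hq.2 hqu hpq x hx y hy hyu hxy) hq.1
        intro p hp q hq hqu hpq p' hp' q' hq' hqu' hpq'
        obtain rfl := hnew p hp q hq hqu hpq
        obtain rfl := hnew p' hp' q' hq' hqu' hpq'
        refine hdeg' p' x q q' hxy.symm hpq hpq' ?_ ?_
        · rintro rfl
          exact hq (Finset.mem_insert_of_mem hx)
        · rintro rfl
          exact hq' (Finset.mem_insert_of_mem hx)
  intro A hA B hB hAB
  have hpos : 0 < B.card := Finset.card_pos.2 ⟨v, (mem_subtreesAvoiding.1 hB).1.1⟩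
  have hAB : A.card = B.card := hAB
  exact (key (B.card - 1) B hB (by omega)).1 A hA (by omega)

theorem rootConn_univ_erase {V : Type*} [Fintype V] [DecidableEq V] {G : SimpleGraph V}
    (hG : G.Connected) {u v : V} (huv : G.Adj u v) (hu : ∀ w, G.Adj u w → w = v) :
    RootConn G v (Finset.univ.erase u) := by
  refine ⟨by simp [huv.ne'], fun P hP hstep x hx => ?_⟩
  have walk : ∀ {a b : V}, G.Walk a b → (a = u ∨ P a) → (b = u ∨ P b) := by
    intro a b p
    induction p with
    | nil => exact id
    | @cons a c _ hac _ ih =>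
      intro ha
      refine ih ?_
      by_cases hcu : c = u
      · exact Or.inl hcu
      right
      by_cases hau : a = u
      · subst hau
        exact hu c hac ▸ hP
      · exact hstep a (by simp [hau]) c (by simp [hcu]) (ha.resolve_left hau) hac
  obtain ⟨p⟩ := hG.preconnected v x
  exact (walk p (Or.inr hP)).resolve_left (Finset.ne_of_mem_erase hx)

/-- A vertex `x ≠ v` of a rooted connected set is attached, through a unique neighbour, to a
rooted connected subset that misses it. -/
theorem RootConn.exists_unique_attachment {V : Type*} [DecidableEq V]
    {G : SimpleGraph V} {v x : V} {W : Finset V} (hW : RootConn G v W) (hx : x ∈ W)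
    (hxv : x ≠ v) :
    ∃ C ⊆ W, RootConn G v C ∧ x ∉ C ∧ ∃ y ∈ C, G.Adj y x ∧ ∀ y' ∈ C, G.Adj y' x → y' = y := by
  let Q : ℕ → Prop := fun n =>
    ∃ C ⊆ W, RootConn G v C ∧ x ∉ C ∧ (∃ y ∈ C, G.Adj y x) ∧ C.card = n
  have hQ : ∃ n, Q n := by
    by_contra hno
    have grow : ∀ k, ∃ C ⊆ W, RootConn G v C ∧ x ∉ C ∧ C.card = k + 1 := by
      intro k
      induction k with
      | zero =>
        exact ⟨{v}, by simpa using hW.1, RootConn.singleton G v, by simpa using hxv, by simp⟩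
      | succ k ih =>
        obtain ⟨C, hCW, hC, hxC, hk⟩ := ih
        obtain ⟨p, -, hp, q, hqW, hqC, hpq⟩ := hW.exists_adj hC.1 (fun h => hxC (h hx))
        have hqx : q ≠ x := by
          rintro rfl
          exact hno ⟨_, C, hCW, hC, hxC, ⟨p, hp, hpq⟩, rfl⟩
        refine ⟨Insert.insert q C, Finset.insert_subset hqW hCW, hC.insert hp hpq, ?_, ?_⟩
        · simp [hqx.symm, hxC]
        · rw [Finset.card_insert_of_notMem hqC, hk]
    obtain ⟨C, hCW, -, -, hk⟩ := grow W.card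
    have := Finset.card_le_card hCW
    omega
  classical
  obtain ⟨C, hCW, hC, hxC, ⟨y, hy, hyx⟩, hcard⟩ := Nat.find_spec hQ
  refine ⟨C, hCW, hC, hxC, y, hy, hyx, fun y' hy' hyx' => ?_⟩
  rcases Nat.lt_or_ge C.card 2 with h1 | h2
  · exact Finset.card_le_one.1 (by omega) y' hy' y hy
  · obtain ⟨D, p, z, hD, hDk, hp, hz, hpz, rfl⟩ := hC.exists_eq_insert (k := C.card - 2) (by omega)
    have hmin : ∀ d ∈ D, ¬ G.Adj d x := by
      intro d hd hdx
      refine Nat.find_min hQ (m := D.card) ?_ ⟨D, (Finset.subset_insert _ _).trans hCW, hD,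
        fun h => hxC (Finset.mem_insert_of_mem h), ⟨d, hd, hdx⟩, rfl⟩
      rw [← hcard, Finset.card_insert_of_notMem hz]
      omega
    have hz' : ∀ d ∈ Insert.insert z D, G.Adj d x → d = z := fun d hd hdx =>
      (Finset.mem_insert.1 hd).resolve_right fun h => hmin d h hdx
    rw [hz' y hy hyx, hz' y' hy' hyx']

theorem degree_le_two_of_injOn_card {V : Type*} [Fintype V] [DecidableEq V]
    {G : SimpleGraph V} (hG : G.Connected) {u v : V} (huv : G.Adj u v)
    (hu : ∀ w, G.Adj u w → w = v)
    (hinj : Set.InjOn Finset.card (subtreesAvoiding G v u : Set (Finset V))) (x : V) :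
    (G.neighborSet x).ncard ≤ 2 := by
  have hext : ∀ C, RootConn G v C → u ∉ C → ∀ x ∈ C, ∀ w w', G.Adj x w → G.Adj x w' →
      w ∉ C → w' ∉ C → w ≠ u → w' ≠ u → w = w' := by
    intro C hC huC x hx w w' hw hw' hwC hwC' hwu hwu'
    have h := hinj (x₁ := insert w C) (x₂ := insert w' C)
      (mem_subtreesAvoiding.2 ⟨hC.insert hx hw, by simp [huC, hwu.symm]⟩)
      (mem_subtreesAvoiding.2 ⟨hC.insert hx hw', by simp [huC, hwu'.symm]⟩)
      (by rw [Finset.card_insert_of_notMem hwC, Finset.card_insert_of_notMem hwC'])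
    have hmem : w ∈ insert w' C := h ▸ Finset.mem_insert_self w C
    exact (Finset.mem_insert.1 hmem).resolve_right hwC
  by_contra! hlt
  obtain ⟨a, b, c, ha, hb, hc, hab, hac, hbc⟩ :=
    (Set.two_lt_ncard_iff (Set.toFinite (G.neighborSet x))).1 hlt
  rw [SimpleGraph.mem_neighborSet] at ha hb hc
  have hbad : ∃ z, ∀ w w', G.Adj x w → G.Adj x w' → w ≠ z → w' ≠ z → w = w' := by
    by_cases hxu : x = u
    · subst hxu
      exact ⟨v, fun w w' hw _ hwv _ => absurd (hu w hw) hwv⟩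
    by_cases hxv : x = v
    · subst hxv
      refine ⟨u, fun w w' hw hw' hwu hwu' => ?_⟩
      exact hext {x} (RootConn.singleton G x) (by simpa using huv.ne) x (by simp) w w' hw hw'
        (by simpa using hw.ne') (by simpa using hw'.ne') hwu hwu'
    · obtain ⟨C, hCW, hC, hxC, y, hy, hyx, huniq⟩ :=
        (rootConn_univ_erase hG huv hu).exists_unique_attachment (x := x) (by simp [hxu]) hxv
      have huC : u ∉ C := fun h => Finset.notMem_erase u _ (hCW h)
      have hne : ∀ w, G.Adj x w → w ≠ u := by
        rintro w hw rfl
        exact hxv (hu x hw.symm)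
      have hout : ∀ w, G.Adj x w → w ≠ y → w ∉ insert x C := by
        intro w hw hwy h
        rcases Finset.mem_insert.1 h with h | h
        · exact hw.ne' h
        · exact hwy (huniq w h hw.symm)
      refine ⟨y, fun w w' hw hw' hwy hwy' => ?_⟩
      exact hext (insert x C) (hC.insert hy hyx) (by simp [huC, Ne.symm hxu]) x (by simp) w w'
        hw hw' (hout w hw hwy) (hout w' hw' hwy') (hne w hw) (hne w' hw')
  obtain ⟨z, hz⟩ := hbad
  by_cases haz : a = z
  · exact hbc (hz b c hb hc (haz ▸ hab.symm) (haz ▸ hac.symm))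
  · by_cases hbz : b = z
    · exact hac (hz a c ha hc haz (hbz ▸ hbc.symm))
    · exact hab (hz a b ha hb haz hbz)

/-- The comparison of mean orders in terms of the numbers `a`, `b` of subtrees on the two sides
of an edge and their total orders `a'`, `b'`. -/
theorem mean_ratio_le {a b a' b' : ℝ} (ha : 1 ≤ a) (hb : 1 ≤ b) (ha' : a ≤ a')
    (hb' : 2 * b' ≤ b * b + b) :
    (b' + (a' * b + a * b')) / (b + a * b) ≤ (1 + (a' * b + a * b')) / (1 + a * b) ∧
      ((1 + (a' * b + a * b')) / (1 + a * b) = (b' + (a' * b + a * b')) / (b + a * b) →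
        b = 1 ∨ (a = 1 ∧ 2 * b' = b * b + b)) := by
  have h1 : 0 < b + a * b := by positivity
  have h2 : 0 < 1 + a * b := by positivity
  have e : (1 + (a' * b + a * b')) * (b + a * b) - (b' + (a' * b + a * b')) * (1 + a * b) =
      (1 + a) / 2 * (b * b + b - 2 * b') + ((a' - a) + (a - 1) / 2) * (b * (b - 1)) := by ring
  have p1 : 0 ≤ (1 + a) / 2 * (b * b + b - 2 * b') :=
    mul_nonneg (by linarith) (by linarith)
  have p2 : 0 ≤ ((a' - a) + (a - 1) / 2) * (b * (b - 1)) :=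
    mul_nonneg (by linarith) (mul_nonneg (by linarith) (by linarith))
  refine ⟨?_, fun h => ?_⟩
  · rw [div_le_div_iff₀ h1 h2]
    linarith
  · rw [div_eq_div_iff h2.ne' h1.ne'] at h
    have q1 : (1 + a) / 2 * (b * b + b - 2 * b') = 0 := by linarith
    have q2 : ((a' - a) + (a - 1) / 2) * (b * (b - 1)) = 0 := by linarith
    rcases mul_eq_zero.1 q2 with q | q
    · right
      refine ⟨by linarith, ?_⟩
      rcases mul_eq_zero.1 q1 with r | r <;> linarith
    · left
      rcases mul_eq_zero.1 q with r | r <;> linarith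

/-- For adjacent vertices `u, v` of a tree `T` and `T' = T_{(v→u)}`:
`μ(T'; v) ≥ μ(T; v)`, with equality iff `v` is a leaf of `T` or `T` is a path with `u`
as a leaf. -/
theorem kelmans_meanOrder_ge_self {V : Type*} [Fintype V] [DecidableEq V]
    (G : SimpleGraph V) (hG : G.IsTree) (u v : V) (huv : G.Adj u v) :
    meanOrder (kelmans G v u) v ≥ meanOrder G v ∧
      (meanOrder (kelmans G v u) v = meanOrder G v ↔
        (G.neighborSet v).ncard = 1 ∨ (IsPathGraph G ∧ (G.neighborSet u).ncard = 1)) := by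
  set a := (subtreesAvoiding G u v).card with ha
  set b := (subtreesAvoiding G v u).card with hb
  have hapos : 1 ≤ a := Finset.card_pos.2 ⟨_, singleton_mem_subtreesAvoiding G huv.ne'⟩
  have hbpos : 1 ≤ b := Finset.card_pos.2 ⟨_, singleton_mem_subtreesAvoiding G huv.ne⟩
  obtain ⟨hle, hiff⟩ := two_mul_sum_card_subtreesAvoiding_le G v u
  rw [← hb] at hle hiff
  have ha' : a ≤ ∑ A ∈ subtreesAvoiding G u v, A.card := by
    rw [ha, Finset.card_eq_sum_ones]
    exact Finset.sum_le_sum fun A hA =>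
      Finset.card_pos.2 ⟨u, (mem_subtreesAvoiding.1 hA).1.1⟩
  have hleafv : (G.neighborSet v).ncard = 1 ↔ b = 1 := by
    rw [ncard_neighborSet_eq_one_iff huv.symm, hb, card_subtreesAvoiding_eq_one_iff huv.symm,
      subtreesAvoiding_eq_singleton_iff huv.symm]
  have hleafu : (G.neighborSet u).ncard = 1 ↔ a = 1 := by
    rw [ncard_neighborSet_eq_one_iff huv, ha, card_subtreesAvoiding_eq_one_iff huv,
      subtreesAvoiding_eq_singleton_iff huv]
  have hT : meanOrder G v = _ := meanOrder_eq G v u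
  have hK : meanOrder (kelmans G v u) v = _ := meanOrder_eq (kelmans G v u) v u
  rw [card_subtreesBoth hG.isAcyclic huv, sum_card_subtreesBoth hG.isAcyclic huv] at hT
  rw [subtreesAvoiding_kelmans huv, subtreesBoth_kelmans huv,
    card_subtreesBoth hG.isAcyclic huv, sum_card_subtreesBoth hG.isAcyclic huv] at hK
  simp only [Finset.sum_singleton, Finset.card_singleton, Nat.cast_one] at hK
  rw [← Nat.cast_sum, ← Nat.cast_sum, ← ha, ← hb] at hT hK
  obtain ⟨hmean, heq⟩ := mean_ratio_le (a := a) (b := b)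
    (a' := (∑ A ∈ subtreesAvoiding G u v, A.card : ℕ))
    (b' := (∑ A ∈ subtreesAvoiding G v u, A.card : ℕ))
    (by exact_mod_cast hapos) (by exact_mod_cast hbpos) (by exact_mod_cast ha')
    (by exact_mod_cast hle)
  rw [← hT, ← hK] at hmean heq
  refine ⟨hmean, fun h => ?_, ?_⟩
  · rcases heq h with h1 | ⟨h1, h2⟩
    · exact Or.inl (hleafv.2 (by exact_mod_cast h1))
    · have h1 : (G.neighborSet u).ncard = 1 := hleafu.2 (by exact_mod_cast h1)
      refine Or.inr ⟨⟨hG, ?_⟩, h1⟩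
      exact degree_le_two_of_injOn_card hG.connected huv
        ((ncard_neighborSet_eq_one_iff huv).1 h1) (hiff.1 (by exact_mod_cast h2))
  · rw [hT, hK]
    rintro (h | ⟨⟨-, h⟩, hu⟩)
    · have hb1 := hleafv.1 h
      have hF := (card_subtreesAvoiding_eq_one_iff huv.symm).1 hb1
      simp [hF, hb1]
    · have ha1 := hleafu.1 hu
      have hF := (card_subtreesAvoiding_eq_one_iff huv).1 ha1
      have h2 := hiff.2 (injOn_card_of_degree_le_two huv h)
      have h2 : (2 : ℝ) * (∑ A ∈ subtreesAvoiding G v u, A.card : ℕ) = b * b + b := by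
        exact_mod_cast h2
      have hb0 : (1 : ℝ) ≤ b := by exact_mod_cast hbpos
      rw [hF, ha1, Finset.sum_singleton, Finset.card_singleton, Nat.cast_one,
        div_eq_div_iff (by positivity) (by positivity)]
      linear_combination (-1 : ℝ) * h2
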